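/- If H ⊆ P(ℕ) is hereditary and nonmeager, then there exists k ∈ ℕ such that the set {S ⊆ ℕ : S \ {0,1,…,k−1} ∈ H} is everywhere nonmeager, i.e., its intersection with every nonempty open subset of P(ℕ) is nonmeager. -/

import Mathlib

open scoped Classical in
/-- The characteristic function of a subset of `ℕ`, as a point of the Cantor space `ℕ → Bool`.
This identifies `𝒫(ℕ)` with the Cantor space `2^ℕ` carrying the product topology. -/
noncomputable def charFun (S : Set ℕ) : ℕ → Bool := fun n => if n ∈ S then true else false

/-- A family of subsets of `ℕ` is meager if the corresponding subset of the Cantor space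
`ℕ → Bool` is meager. -/
def MeagerFamily (J : Set (Set ℕ)) : Prop := IsMeagre (charFun '' J)

/-- A hereditary family of subsets of `ℕ`. -/
def Hereditary (H : Set (Set ℕ)) : Prop := ∀ A B : Set ℕ, A ⊆ B → B ∈ H → A ∈ H

/-- A family of subsets of `ℕ` is everywhere nonmeager if its intersection with every nonempty
open subset of the Cantor space is nonmeager. -/
def EverywhereNonmeagerFamily (H : Set (Set ℕ)) : Prop :=
  ∀ U : Set (ℕ → Bool), IsOpen U → U.Nonempty → ¬ IsMeagre (charFun '' H ∩ U)

theorem charFun_support (x : ℕ → Bool) : charFun {i | x i = true} = x := by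
  funext i
  cases h : x i <;> simp [charFun, h]

theorem mem_image_charFun_iff (J : Set (Set ℕ)) (x : ℕ → Bool) :
    x ∈ charFun '' J ↔ {i | x i = true} ∈ J := by
  constructor
  · rintro ⟨S, hS, rfl⟩
    convert hS using 1
    ext i
    simp [charFun]
  · exact fun h => ⟨_, h, charFun_support x⟩

/-- The homeomorphism of the Cantor space that flips the coordinates in `F`. -/
def flipHomeomorph (F : Finset ℕ) : (ℕ → Bool) ≃ₜ (ℕ → Bool) where
  toFun x i := xor (x i) (decide (i ∈ F))
  invFun x i := xor (x i) (decide (i ∈ F))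
  left_inv x := by funext i; simp
  right_inv x := by funext i; simp
  continuous_toFun := continuous_pi fun i =>
    (continuous_of_discreteTopology (f := fun b => xor b (decide (i ∈ F)))).comp
      (continuous_apply i)
  continuous_invFun := continuous_pi fun i =>
    (continuous_of_discreteTopology (f := fun b => xor b (decide (i ∈ F)))).comp
      (continuous_apply i)

theorem flipHomeomorph_apply (F : Finset ℕ) (x : ℕ → Bool) (i : ℕ) :
    flipHomeomorph F x i = xor (x i) (decide (i ∈ F)) := rfl

/-- If the tail family of a hereditary family `H` at `k` is meager in some nonempty open set, then
so is the family of members of `H` containing a suitable finite subset of `[k, ∞)`. -/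
theorem Hereditary.exists_finset_isMeagre {H : Set (Set ℕ)} (hher : Hereditary H) {k : ℕ}
    (hk : ¬ EverywhereNonmeagerFamily {S : Set ℕ | S \ Set.Iio k ∈ H}) :
    ∃ I : Finset ℕ, IsMeagre (charFun '' H ∩ {x | ∀ i ∈ I, k ≤ i → x i = true}) := by
  simp only [EverywhereNonmeagerFamily, not_forall, not_not] at hk
  obtain ⟨U, hU, ⟨y, hy⟩, hM⟩ := hk
  obtain ⟨I, u, hu, hIU⟩ := isOpen_pi_iff.1 hU y hy
  refine ⟨I, (isMeagre_iUnion fun F : Finset ℕ => hM.preimage_of_isOpenMap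
    (flipHomeomorph F).continuous (flipHomeomorph F).isOpenMap).mono ?_⟩
  rintro x ⟨hxH, hx⟩
  rw [mem_image_charFun_iff] at hxH
  refine Set.mem_iUnion.2 ⟨I.filter fun i => x i ≠ y i, ?_, hIU fun i hi => ?_⟩
  · rw [mem_image_charFun_iff]
    refine hher _ _ ?_ hxH
    rintro i ⟨hi, hik⟩
    by_contra hxi
    have hxi' : x i = false := by simpa using hxi
    have hiI : i ∈ I := by
      by_contra hiI
      simp [flipHomeomorph_apply, hxi', hiI] at hi
    exact hxi (hx i hiI (by simpa using hik))
  · have hflip : flipHomeomorph (I.filter fun i => x i ≠ y i) x i = y i := by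
      have hiI : i ∈ I := hi
      cases h : x i <;> cases h' : y i <;> simp [flipHomeomorph_apply, hiI, h, h']
    rw [hflip]
    exact (hu i hi).2

theorem isOpen_setOf_forall_mem_finset (I : Finset ℕ) (k : ℕ) :
    IsOpen {x : ℕ → Bool | ∀ i ∈ I, k ≤ i → x i = true} := by
  have h : {x : ℕ → Bool | ∀ i ∈ I, k ≤ i → x i = true} =
      ⋂ i ∈ I, {x : ℕ → Bool | k ≤ i → x i = true} := by
    ext x
    simp
  rw [h]
  exact isOpen_biInter_finset fun i _ =>
    (isOpen_discrete {b : Bool | k ≤ i → b = true}).preimage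
      (continuous_apply (A := fun _ : ℕ => Bool) i)

theorem dense_iUnion_setOf_forall_mem_finset (I : ℕ → Finset ℕ) :
    Dense (⋃ k, {x : ℕ → Bool | ∀ i ∈ I k, k ≤ i → x i = true}) := by
  refine dense_iff_inter_open.2 fun U hU ⟨y, hy⟩ => ?_
  obtain ⟨J, u, hu, hJU⟩ := isOpen_pi_iff.1 hU y hy
  obtain ⟨k, hk⟩ := J.exists_nat_subset_range
  refine ⟨fun i => if i < k then y i else true, hJU fun i hi => ?_,
    Set.mem_iUnion.2 ⟨k, fun i _ hki => if_neg hki.not_gt⟩⟩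
  have hik : i < k := Finset.mem_range.1 (hk hi)
  simpa [hik] using (hu i hi).2

/-- If `H ⊆ 𝒫(ℕ)` is hereditary and nonmeager, then there is `k` such that
`{S : S \ {0,…,k-1} ∈ H}` is everywhere nonmeager. -/
theorem hereditary_nonmeager_tail_everywhere_nonmeager (H : Set (Set ℕ))
    (hher : Hereditary H) (hnm : ¬ MeagerFamily H) :
    ∃ k : ℕ, EverywhereNonmeagerFamily {S : Set ℕ | S \ Set.Iio k ∈ H} := by
  by_contra! hcon
  choose I hI using fun k => hher.exists_finset_isMeagre (hcon k)
  have hO : IsMeagre (⋃ k, {x : ℕ → Bool | ∀ i ∈ I k, k ≤ i → x i = true})ᶜ := by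
    rw [IsMeagre, compl_compl]
    exact residual_of_dense_open (isOpen_iUnion fun k => isOpen_setOf_forall_mem_finset _ _)
      (dense_iUnion_setOf_forall_mem_finset I)
  refine hnm (((isMeagre_iUnion hI).union hO).mono fun x hx => ?_)
  rw [← Set.inter_iUnion]
  by_cases h : x ∈ ⋃ k, {x : ℕ → Bool | ∀ i ∈ I k, k ≤ i → x i = true}
  · exact Or.inl ⟨hx, h⟩
  · exact Or.inr h
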